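/- Let n ≥ 2, l ≥ 0 and m ≥ 0 be integers with 2m+1 < n, and define the polynomial φ_l(r) = [Γ(m+1)Γ(l+(n+1)/2+m)/(Γ(2m+1)Γ(l+(n+1)/2))] · F(l+(n−1)/2−m, −m; l+(n+1)/2; r) (a polynomial of degree m in r, since the hypergeometric series terminates). Then for every integer 0 ≤ k ≤ m, the k-th derivative of φ_l at r = 1 equals φ_l^{(k)}(1) = (−1)^k (l+(n−1)/2−m)_k (−m)_k / (−2m)_k; in particular φ_l(1) = 1. -/

import Mathlib

open Real Filter
open scoped Real BigOperators Nat Topology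

noncomputable section

/-- Pochhammer symbol `(a)_k`. -/
def poch (a : ℝ) (k : ℕ) : ℝ := (ascPochhammer ℝ k).eval a

/-- Gauss hypergeometric function `F(a,b;c;z)`. -/
def hyperF (a b c z : ℝ) : ℝ :=
  ∑' k : ℕ, poch a k * poch b k / (poch c k * (k : ℕ)!) * z ^ k


/-- The terminating radial profile `φ_l` of the extension `V_m`. -/
def phiPoly (n l m : ℕ) (r : ℝ) : ℝ :=
  Gamma ((m : ℝ) + 1) * Gamma ((l : ℝ) + ((n : ℝ) + 1) / 2 + m) /
      (Gamma (2 * (m : ℝ) + 1) * Gamma ((l : ℝ) + ((n : ℝ) + 1) / 2)) *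
    hyperF ((l : ℝ) + ((n : ℝ) - 1) / 2 - m) (-(m : ℝ)) ((l : ℝ) + ((n : ℝ) + 1) / 2) r

lemma poch_zero (a : ℝ) : poch a 0 = 1 := by simp [poch]

lemma poch_succ (a : ℝ) (k : ℕ) : poch a (k + 1) = poch a k * (a + k) := by
  simp [poch, ascPochhammer_succ_eval]

lemma poch_succ_left (a : ℝ) (k : ℕ) : poch a (k + 1) = a * poch (a + 1) k := by
  simp [poch, ascPochhammer_succ_left]

lemma poch_pos (a : ℝ) (k : ℕ) (ha : 0 < a) : 0 < poch a k := ascPochhammer_pos k a ha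

lemma poch_neg_eq_zero (N k : ℕ) (h : N < k) : poch (-(N : ℝ)) k = 0 := by
  induction k, h using Nat.le_induction with
  | base => rw [poch_succ]; simp
  | succ k _ ih => rw [poch_succ, ih, zero_mul]

lemma hyperF_eq_sum (a c z : ℝ) (N M : ℕ) (h : N < M) : hyperF a (-(N : ℝ)) c z =
    ∑ k ∈ Finset.range M, poch a k * poch (-(N : ℝ)) k / (poch c k * (k : ℕ)!) * z ^ k := by
  unfold hyperF
  apply tsum_eq_sum
  intro k hk
  rw [Finset.mem_range, not_lt] at hk
  rw [poch_neg_eq_zero N k (by omega)]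
  simp

lemma hyperF_hasDerivAt (a c z : ℝ) (hc : 0 < c) (N : ℕ) :
    HasDerivAt (hyperF a (-((N + 1 : ℕ) : ℝ)) c)
      (a * (-((N + 1 : ℕ) : ℝ)) / c * hyperF (a + 1) (-(N : ℝ)) (c + 1) z) z := by
  have e : hyperF a (-((N + 1 : ℕ) : ℝ)) c = fun z => ∑ k ∈ Finset.range (N + 2),
      poch a k * poch (-((N + 1 : ℕ) : ℝ)) k / (poch c k * (k : ℕ)!) * z ^ k := by
    funext z
    exact hyperF_eq_sum a c z (N + 1) (N + 2) (by omega)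
  rw [e]
  have hd := HasDerivAt.fun_sum (u := Finset.range (N + 2)) (x := z)
    (A := fun (k : ℕ) (z : ℝ) =>
      poch a k * poch (-((N + 1 : ℕ) : ℝ)) k / (poch c k * (k : ℕ)!) * z ^ k)
    (fun k _ => (hasDerivAt_pow k z).const_mul _)
  refine hd.congr_deriv (Eq.symm ?_)
  rw [Finset.sum_range_succ', hyperF_eq_sum (a + 1) (c + 1) z N (N + 1) (by omega),
    Finset.mul_sum]
  simp only [Nat.cast_zero, zero_mul, mul_zero, add_zero]
  apply Finset.sum_congr rfl
  intro k _
  have hp := poch_pos (c + 1) k (by linarith)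
  have hf : (0 : ℝ) < (k ! : ℕ) := by exact_mod_cast k.factorial_pos
  have hb : (-((N + 1 : ℕ) : ℝ)) + 1 = -(N : ℝ) := by push_cast; ring
  rw [poch_succ_left, poch_succ_left (-((N + 1 : ℕ) : ℝ)), poch_succ_left c, hb,
    Nat.factorial_succ]
  push_cast
  try simp only [Nat.add_sub_cancel]
  field_simp

lemma hyperF_contig (a c : ℝ) (hc : 0 < c) (N : ℕ) :
    hyperF a (-((N + 1 : ℕ) : ℝ)) c 1 =
      hyperF a (-(N : ℝ)) c 1 - a / c * hyperF (a + 1) (-(N : ℝ)) (c + 1) 1 := by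
  rw [hyperF_eq_sum a c 1 (N + 1) (N + 2) (by omega), hyperF_eq_sum a c 1 N (N + 2) (by omega),
    hyperF_eq_sum (a + 1) (c + 1) 1 N (N + 1) (by omega),
    Finset.sum_range_succ', Finset.sum_range_succ' _ (N + 1), Finset.mul_sum,
    add_sub_right_comm, ← Finset.sum_sub_distrib]
  simp only [poch_zero, add_left_inj]
  apply Finset.sum_congr rfl
  intro k _
  have hp := poch_pos (c + 1) k (by linarith)
  have hf : (0 : ℝ) < (k ! : ℕ) := by exact_mod_cast k.factorial_pos
  have hb : (-((N + 1 : ℕ) : ℝ)) + 1 = -(N : ℝ) := by push_cast; ring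
  rw [poch_succ_left, poch_succ_left (-((N + 1 : ℕ) : ℝ)), poch_succ_left c, hb,
    poch_succ (-(N : ℝ)), Nat.factorial_succ]
  push_cast
  simp only [one_pow, mul_one]
  field_simp
  ring

lemma chu_vandermonde (N : ℕ) : ∀ a c : ℝ, 0 < c →
    hyperF a (-(N : ℝ)) c 1 = poch (c - a) N / poch c N := by
  induction N with
  | zero =>
    intro a c _
    rw [hyperF_eq_sum a c 1 0 1 (by omega)]
    simp [poch_zero]
  | succ N ih =>
    intro a c hc
    rw [hyperF_contig a c hc, ih a c hc, ih (a + 1) (c + 1) (by linarith)]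
    have h1 := poch_pos c N hc
    have h2 := poch_pos (c + 1) N (by linarith)
    have h3 : poch c N * (c + N) = c * poch (c + 1) N := by
      rw [← poch_succ, poch_succ_left]
    have h4 : c + 1 - (a + 1) = c - a := by ring
    have h5 : (0 : ℝ) < c + N := by positivity
    have h6 : poch (c + 1) N = poch c N * (c + N) / c := by field_simp; linarith
    rw [poch_succ, poch_succ, h4, h6]
    field_simp
    ring

lemma iter_hyperF (N k : ℕ) : ∀ a c C : ℝ, 0 < c →
    iteratedDeriv k (fun z => C * hyperF a (-((N + k : ℕ) : ℝ)) c z) 1 =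
      C * (poch a k * poch (-((N + k : ℕ) : ℝ)) k * poch (c - a) N / poch c (N + k)) := by
  induction k with
  | zero =>
    intro a c C hc
    simp only [iteratedDeriv_zero, poch_zero, add_zero, one_mul]
    rw [chu_vandermonde N a c hc]
  | succ k ih =>
    intro a c C hc
    rw [iteratedDeriv_succ']
    have e : deriv (fun z => C * hyperF a (-((N + (k + 1) : ℕ) : ℝ)) c z) =
        fun z => (C * (a * (-((N + k + 1 : ℕ) : ℝ)) / c)) *
          hyperF (a + 1) (-((N + k : ℕ) : ℝ)) (c + 1) z := by
      funext z
      rw [← add_assoc N k 1, ((hyperF_hasDerivAt a c z hc (N + k)).const_mul C).deriv]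
      ring
    have hb : (-((N + (k + 1) : ℕ) : ℝ)) + 1 = -((N + k : ℕ) : ℝ) := by push_cast; ring
    have hp := poch_pos (c + 1) (N + k) (by linarith)
    rw [e, ih (a + 1) (c + 1) _ (by linarith), poch_succ_left a, poch_succ_left (-_), hb,
      ← add_assoc N k 1, poch_succ_left c, show c + 1 - (a + 1) = c - a by ring]
    field_simp

lemma Gamma_add_nat (c : ℝ) (hc : 0 < c) (m : ℕ) : Gamma (c + m) = poch c m * Gamma c := by
  induction m with
  | zero => simp [poch_zero]
  | succ m ih =>
    push_cast
    rw [← add_assoc, Gamma_add_one (by positivity), ih, poch_succ]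
    ring

lemma factorial_poch (m N : ℕ) : (m ! : ℝ) * poch ((m : ℝ) + 1) N = ((m + N)! : ℕ) := by
  induction N with
  | zero => simp [poch_zero]
  | succ N ih =>
    rw [poch_succ, ← mul_assoc, ih, ← add_assoc, Nat.factorial_succ]
    push_cast
    ring

lemma poch_neg (M k : ℕ) : poch (-((M + k : ℕ) : ℝ)) k * (M ! : ℕ) =
    (-1) ^ k * ((M + k)! : ℕ) := by
  induction k with
  | zero => simp [poch_zero]
  | succ k ih =>
    have hb : (-((M + (k + 1) : ℕ) : ℝ)) + 1 = -((M + k : ℕ) : ℝ) := by push_cast; ring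
    rw [poch_succ_left, hb, mul_assoc, ih, ← add_assoc, Nat.factorial_succ]
    push_cast
    ring

theorem phiPoly_derivatives_at_one
    (n l m : ℕ) (hn : 2 ≤ n) (hmn : 2 * m + 1 < n) :
    (∀ k ≤ m, iteratedDeriv k (phiPoly n l m) 1 =
      (-1 : ℝ) ^ k * (poch ((l : ℝ) + ((n : ℝ) - 1) / 2 - m) k * poch (-(m : ℝ)) k /
        poch (-(2 * (m : ℝ))) k)) ∧
    phiPoly n l m 1 = 1 := by
  have key : ∀ k ≤ m, iteratedDeriv k (phiPoly n l m) 1 =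
      (-1 : ℝ) ^ k * (poch ((l : ℝ) + ((n : ℝ) - 1) / 2 - m) k * poch (-(m : ℝ)) k /
        poch (-(2 * (m : ℝ))) k) := by
    intro k hk
    obtain ⟨N, rfl⟩ := Nat.exists_eq_add_of_le' hk
    have hc : (0 : ℝ) < (l : ℝ) + ((n : ℝ) + 1) / 2 := by positivity
    unfold phiPoly
    rw [iter_hyperF N k _ _ _ hc, Gamma_add_nat _ hc, Gamma_nat_eq_factorial]
    have h2 : 2 * ((N + k : ℕ) : ℝ) = ((N + k + N + k : ℕ) : ℝ) := by push_cast; ring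
    rw [h2, Gamma_nat_eq_factorial]
    have hca : (l : ℝ) + ((n : ℝ) + 1) / 2 - ((l : ℝ) + ((n : ℝ) - 1) / 2 - (N + k : ℕ)) =
      ((N + k : ℕ) : ℝ) + 1 := by ring
    rw [hca]
    have hA := factorial_poch (N + k) N
    have hB := poch_neg (N + k + N) k
    have hG := Gamma_pos_of_pos hc
    have hP := poch_pos _ (N + k) hc
    have f1 : (0 : ℝ) < ((N + k + N)! : ℕ) := by exact_mod_cast Nat.factorial_pos _
    have f2 : (0 : ℝ) < ((N + k + N + k)! : ℕ) := by exact_mod_cast Nat.factorial_pos _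
    have f3 : (0 : ℝ) < ((N + k)! : ℕ) := by exact_mod_cast Nat.factorial_pos _
    rw [← eq_div_iff f1.ne'] at hB
    rw [mul_comm, ← eq_div_iff f3.ne'] at hA
    rw [hB, hA]
    have hs : ((-1 : ℝ) ^ k) ≠ 0 := by positivity
    generalize poch ((l : ℝ) + ((n : ℝ) + 1) / 2) (N + k) = P at *
    generalize Gamma ((l : ℝ) + ((n : ℝ) + 1) / 2) = G at *
    generalize poch ((l : ℝ) + ((n : ℝ) - 1) / 2 - (N + k : ℕ)) k = A at *
    field_simp
  refine ⟨key, ?_⟩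
  have := key 0 (Nat.zero_le _)
  simpa [poch_zero] using this
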